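/- Let n ≥ 1 and let m be a positive integer. Then, as an identity of rational functions in ℚ(x_1,…,x_n), the Schur polynomial s_{(m^n)} in the 2n−1 variables (x_1, x_1^{−1}, …, x_{n−1}, x_{n−1}^{−1}, x_n) equals the sum of the intermediate symplectic characters sp^{(n−1,1)}_λ(x_1,…,x_{n−1} | x_n) over all λ ∈ Even′((m^n)) if n is even, and over all λ ∈ Odd′((m^n)) if n is odd. -/

import Mathlib

open Matrix BigOperators
open scoped Classical

noncomputable section

/-- The field `ℚ(t_1, …, t_n)` of rational functions in `n` indeterminates over `ℚ`. -/
abbrev FF (n : ℕ) : Type := FractionRing (MvPolynomial (Fin n) ℚ)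

/-- The `i`-th indeterminate, viewed as an element of `FF n`. -/
def gen (n : ℕ) (i : Fin n) : FF n :=
  algebraMap (MvPolynomial (Fin n) ℚ) (FF n) (MvPolynomial.X i)

variable {F : Type*} [Field F]

/-- Symplectic character `sp_λ(z_1, …, z_N)` for an integer weight `μ`. -/
def spP {N : ℕ} (z : Fin N → F) (μ : Fin N → ℤ) : F :=
  Matrix.det (Matrix.of fun i j : Fin N =>
      z j ^ (μ i + (N : ℤ) - (i : ℕ)) - z j ^ (-(μ i + (N : ℤ) - (i : ℕ)))) /
  Matrix.det (Matrix.of fun i j : Fin N =>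
      z j ^ ((N : ℤ) - (i : ℕ)) - z j ^ (-((N : ℤ) - (i : ℕ))))

/-- The matrix `Ā_λ` of the bialternant formula for the intermediate symplectic character
`sp^{(k, N-k)}` with integer weight `μ`. -/
def interMatP {N : ℕ} (k : ℕ) (z : Fin N → F) (μ : Fin N → ℤ) : Matrix (Fin N) (Fin N) F :=
  Matrix.of fun i j : Fin N =>
    if (j : ℕ) < k then
      z j ^ (μ i + (k : ℤ) - (i : ℕ)) /
          ∏ l ∈ Finset.univ.filter (fun l : Fin N => k ≤ (l : ℕ)), (1 - (z j)⁻¹ * z l) -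
        z j ^ (-(μ i + (k : ℤ) - (i : ℕ))) /
          ∏ l ∈ Finset.univ.filter (fun l : Fin N => k ≤ (l : ℕ)), (1 - z j * z l)
    else z j ^ (μ i + (N : ℤ) - 1 - (i : ℕ))

/-- Intermediate symplectic character `sp^{(k, N-k)}_μ(z_1, …, z_k | z_{k+1}, …, z_N)`
for an integer weight `μ`. -/
def spInterP {N : ℕ} (k : ℕ) (z : Fin N → F) (μ : Fin N → ℤ) : F :=
  (interMatP k z μ).det / (interMatP k z fun _ => 0).det

/-- Schur function `s_μ(z_1, …, z_N)` as a ratio of alternants (bialternant formula). -/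
def schurP {N : ℕ} (z : Fin N → F) (μ : Fin N → ℤ) : F :=
  Matrix.det (Matrix.of fun i j : Fin N => z j ^ (μ i + (N : ℤ) - 1 - (i : ℕ))) /
  Matrix.det (Matrix.of fun i j : Fin N => z j ^ ((N : ℤ) - 1 - (i : ℕ)))


section PartialFractions

open Polynomial in
/-- Lagrange interpolation of `(w - η) ∏ (t w - 1)` at the points of `V` and at `±1`. -/
theorem sum_lagrange_palindromic (V : Finset F) (η : F) (h2 : (2 : F) ≠ 0)
    (h1 : (1 : F) ∉ V) (hm1 : (-1 : F) ∉ V) :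
    ∑ z ∈ V, (z - η) * (∏ t ∈ V, (t * z - 1)) / ((z ^ 2 - 1) * ∏ t ∈ V.erase z, (z - t)) =
      ∏ t ∈ V, t - (if Even V.card then 1 else η) := by
  have hne : (1 : F) ≠ -1 := by
    intro h
    apply h2
    linear_combination h
  set f : F[X] := (X - C η) * ∏ t ∈ V, (C t * X + C (-1)) with hf
  have hdegprod : (∏ t ∈ V, (C t * X + C (-1 : F))).natDegree ≤ V.card := by
    refine (natDegree_prod_le _ _).trans ?_
    calc _ ≤ ∑ t ∈ V, 1 := Finset.sum_le_sum fun t _ => natDegree_linear_le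
      _ = V.card := by simp
  have hdeg : f.natDegree ≤ 1 + V.card :=
    natDegree_mul_le.trans (add_le_add (natDegree_X_sub_C_le _) hdegprod)
  have hcoeff : f.coeff (V.card + 1) = ∏ t ∈ V, t := by
    have hc : (∏ t ∈ V, (C t * X + C (-1 : F))).coeff V.card = ∏ t ∈ V, t := by
      have := coeff_prod_of_natDegree_le (s := V) (f := fun t : F => C t * X + C (-1 : F)) (n := 1)
        (fun t _ => natDegree_linear_le)
      simpa [coeff_one] using this
    rw [hf, add_comm V.card 1, coeff_mul_add_eq_of_natDegree_le (natDegree_X_sub_C_le _) hdegprod,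
      hc]
    simp
  have hm1' : (-1 : F) ∉ insert (1 : F) V := by simp [hne.symm, hm1]
  have hcard : (insert (-1 : F) (insert 1 V)).card = V.card + 2 := by
    rw [Finset.card_insert_of_notMem hm1', Finset.card_insert_of_notMem h1]
  have key := Lagrange.coeff_eq_sum (s := insert (-1 : F) (insert 1 V)) (v := id) (P := f)
    (fun _ _ _ _ h => h) (by
      rw [hcard]
      refine lt_of_le_of_lt degree_le_natDegree ?_
      exact_mod_cast (by omega : f.natDegree < V.card + 2))
  rw [hcard, show V.card + 2 - 1 = V.card + 1 by omega, hcoeff, Finset.sum_insert hm1',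
    Finset.sum_insert h1] at key
  have heval : ∀ w, f.eval w = (w - η) * ∏ t ∈ V, (t * w - 1) := by
    intro w
    simp [hf, eval_prod, sub_eq_add_neg]
  simp only [id, heval, Finset.erase_insert hm1'] at key
  have hV : ∀ z ∈ V, ∏ j ∈ (insert (-1 : F) (insert 1 V)).erase z, (z - j) =
      (z ^ 2 - 1) * ∏ t ∈ V.erase z, (z - t) := by
    intro z hz
    have hz1 : z ≠ 1 := fun h => h1 (h ▸ hz)
    have hz2 : z ≠ -1 := fun h => hm1 (h ▸ hz)
    rw [Finset.erase_insert_of_ne hz2.symm, Finset.erase_insert_of_ne hz1.symm,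
      Finset.prod_insert (by simp [hne.symm, hm1]), Finset.prod_insert (by simp [h1])]
    ring
  rw [Finset.sum_congr rfl fun z hz => by rw [hV z hz]] at key
  rw [Finset.erase_insert_of_ne hne.symm, Finset.erase_insert h1, Finset.prod_insert hm1,
    Finset.prod_insert h1] at key
  have e1 : ∏ t ∈ V, (t * (1 : F) - 1) = (-1) ^ V.card * ∏ t ∈ V, (1 - t) := by
    rw [← Finset.prod_const, ← Finset.prod_mul_distrib]
    exact Finset.prod_congr rfl fun t _ => by ring
  have e2 : ∏ t ∈ V, (t * (-1 : F) - 1) = ∏ t ∈ V, (-1 - t) :=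
    Finset.prod_congr rfl fun t _ => by ring
  have n1 : ∏ t ∈ V, (1 - t) ≠ 0 :=
    Finset.prod_ne_zero_iff.2 fun t ht h => h1 (by rwa [sub_eq_zero.1 h])
  have n2 : ∏ t ∈ V, (-1 - t) ≠ 0 :=
    Finset.prod_ne_zero_iff.2 fun t ht h => hm1 (by rwa [sub_eq_zero.1 h])
  rw [e1, e2] at key
  have f1 : (-1 - η) * (∏ t ∈ V, (-1 - t)) / ((-1 - 1) * ∏ t ∈ V, (-1 - t)) = (1 + η) / 2 := by
    have : (-1 - 1 : F) ≠ 0 := fun h => h2 (by linear_combination -h)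
    field_simp
    ring
  have f2 : (1 - η) * ((-1) ^ V.card * ∏ t ∈ V, (1 - t)) / ((1 - -1) * ∏ t ∈ V, (1 - t)) =
      (-1) ^ V.card * ((1 - η) / 2) := by
    have : (1 - -1 : F) ≠ 0 := fun h => h2 (by linear_combination h)
    field_simp
    ring
  rw [f1, f2] at key
  rw [key]
  split_ifs with he
  · rw [he.neg_one_pow]
    field_simp
    ring
  · rw [(Nat.not_even_iff_odd.1 he).neg_one_pow]
    field_simp
    ring

/-- A partial fraction identity over a finite set of nonzero points different from `±1`. -/
theorem sum_prod_one_sub_inv (V : Finset F) (η : F) (h2 : (2 : F) ≠ 0)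
    (h0 : (0 : F) ∉ V) (h1 : (1 : F) ∉ V) (hm1 : (-1 : F) ∉ V) :
    ∑ z ∈ V, (1 - η * z⁻¹) * ∏ t ∈ V.erase z, ((1 - z⁻¹ * t⁻¹) / (1 - t * z⁻¹)) =
      1 - (if Even V.card then 1 else η) * ∏ t ∈ V, t⁻¹ := by
  have hp : ∏ t ∈ V, t ≠ 0 := Finset.prod_ne_zero_iff.2 fun t ht h => h0 (h ▸ ht)
  have key := sum_lagrange_palindromic V η h2 h1 hm1
  have : 1 - (if Even V.card then 1 else η) * ∏ t ∈ V, t⁻¹ =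
      (∏ t ∈ V, t)⁻¹ * (∏ t ∈ V, t - (if Even V.card then 1 else η)) := by
    rw [Finset.prod_inv_distrib]
    field_simp
  rw [this, ← key, Finset.mul_sum]
  refine Finset.sum_congr rfl fun z hz => ?_
  have hz0 : z ≠ 0 := fun h => h0 (h ▸ hz)
  have hz1 : z ^ 2 - 1 ≠ 0 := by
    intro h
    rcases mul_self_eq_one_iff.1 (by linear_combination h : z * z = 1) with h | h
    · exact h1 (h ▸ hz)
    · exact hm1 (h ▸ hz)
  have ht : ∏ t ∈ V.erase z, ((1 - z⁻¹ * t⁻¹) / (1 - t * z⁻¹)) =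
      (∏ t ∈ V.erase z, (t * z - 1)) / ((∏ t ∈ V.erase z, t) * ∏ t ∈ V.erase z, (z - t)) := by
    rw [← Finset.prod_mul_distrib, ← Finset.prod_div_distrib]
    refine Finset.prod_congr rfl fun t ht => ?_
    have ht0 : t ≠ 0 := fun h => h0 (h ▸ Finset.mem_of_mem_erase ht)
    have hzt : z - t ≠ 0 := sub_ne_zero.2 (Finset.ne_of_mem_erase ht).symm
    have : 1 - t * z⁻¹ ≠ 0 := by
      intro h
      apply hzt
      linear_combination z * h + t * mul_inv_cancel₀ hz0
    field_simp
  rw [ht, ← Finset.mul_prod_erase V (fun t => t) hz, ← Finset.mul_prod_erase V _ hz]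
  have hp' : ∏ t ∈ V.erase z, t ≠ 0 :=
    Finset.prod_ne_zero_iff.2 fun t ht h => h0 (h ▸ Finset.mem_of_mem_erase ht)
  have hd : ∏ t ∈ V.erase z, (z - t) ≠ 0 :=
    Finset.prod_ne_zero_iff.2 fun t ht => sub_ne_zero.2 (Finset.ne_of_mem_erase ht).symm
  have hz1' : z * z - 1 ≠ 0 := by rwa [← sq]
  field_simp

end PartialFractions

section RectangularSum

/-- The Laplace expansion of the Schur polynomial of the rectangle with `n` rows of length `m`
in the variables `Z`. -/
def rectSum (Z : Finset F) (n : ℕ) (m : ℤ) : F :=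
  ∑ S ∈ Z.powersetCard n, ∏ s ∈ S, (s ^ m * ∏ t ∈ Z \ S, (1 - t * s⁻¹)⁻¹)

/-- Removal of a pair `z`, `z⁻¹` of which only `z` lies in `S` from a term of `rectSum`. -/
theorem rectSum_term_erase {Y : Finset F} {y : F} (hY0 : (0 : F) ∉ Y)
    (hYinv : ∀ z ∈ Y, z⁻¹ ∈ Y) (hy0 : y ≠ 0) (hy : y ∉ Y) {S : Finset F}
    (hS : S ⊆ insert y Y) (m : ℤ) {z : F} (hz : z ∈ S.erase y) (hzS : z⁻¹ ∉ S) :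
    z ^ m * (∏ s ∈ Y.erase z, (1 - s * z⁻¹)⁻¹) *
      ∏ s ∈ S.erase z, (s ^ m *
        ∏ t ∈ insert y ((Y.erase z).erase z⁻¹) \ S.erase z, (1 - t * s⁻¹)⁻¹) =
    (∏ s ∈ S, (s ^ m * ∏ t ∈ insert y Y \ S, (1 - t * s⁻¹)⁻¹)) *
      ((1 - (if y ∈ S then y⁻¹ else y) * z⁻¹) *
        ∏ t ∈ (S.erase y).erase z, ((1 - z⁻¹ * t⁻¹) / (1 - t * z⁻¹))) := by
  have hzS' : z ∈ S := Finset.mem_of_mem_erase hz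
  have hzy : z ≠ y := Finset.ne_of_mem_erase hz
  have hzY : z ∈ Y := by
    have := hS hzS'
    rw [Finset.mem_insert] at this
    tauto
  have hz0 : z ≠ 0 := fun h => hY0 (h ▸ hzY)
  have hziY := hYinv z hzY
  have hziy : z⁻¹ ≠ y := fun h => hy (h ▸ hziY)
  have hset : insert y Y \ S =
      insert z⁻¹ (insert y ((Y.erase z).erase z⁻¹) \ S.erase z) := by
    ext t
    simp only [Finset.mem_sdiff, Finset.mem_insert, Finset.mem_erase]
    grind
  have hnot : z⁻¹ ∉ insert y ((Y.erase z).erase z⁻¹) \ S.erase z := by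
    simp [hziy]
  have hone : ∀ a : F, a ≠ z → 1 - a * z⁻¹ ≠ 0 := by
    intro a ha h
    apply ha
    linear_combination -z * h + (-a) * mul_inv_cancel₀ hz0
  have hone' : ∀ a : F, a ≠ 0 → a ≠ z⁻¹ → 1 - z⁻¹ * a⁻¹ ≠ 0 := by
    intro a ha0 ha h
    apply ha
    linear_combination a * h + z⁻¹ * mul_inv_cancel₀ ha0
  have hSne0 : ∀ s ∈ S, s ≠ 0 := by
    intro s hs h
    have := hS hs
    rw [Finset.mem_insert, h] at this
    rcases this with h | h
    · exact hy0 h.symm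
    · exact hY0 h
  have hprod : ∏ s ∈ S, (s ^ m * ∏ t ∈ insert y Y \ S, (1 - t * s⁻¹)⁻¹) =
      z ^ m * (∏ t ∈ insert y Y \ S, (1 - t * z⁻¹)⁻¹) *
        ((∏ s ∈ S.erase z, (1 - z⁻¹ * s⁻¹)⁻¹) * ∏ s ∈ S.erase z, (s ^ m *
        ∏ t ∈ insert y ((Y.erase z).erase z⁻¹) \ S.erase z, (1 - t * s⁻¹)⁻¹)) := by
    rw [← Finset.mul_prod_erase S _ hzS', ← Finset.prod_mul_distrib]
    congr 1
    refine Finset.prod_congr rfl fun s _ => ?_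
    rw [hset, Finset.prod_insert hnot]
    ring
  have hcore : ∏ s ∈ Y.erase z, (1 - s * z⁻¹)⁻¹ =
      (∏ t ∈ insert y Y \ S, (1 - t * z⁻¹)⁻¹) * (∏ s ∈ S.erase z, (1 - z⁻¹ * s⁻¹)⁻¹) *
      ((1 - (if y ∈ S then y⁻¹ else y) * z⁻¹) *
        ∏ t ∈ (S.erase y).erase z, ((1 - z⁻¹ * t⁻¹) / (1 - t * z⁻¹))) := by
    have hYe : Y.erase z = (S.erase y).erase z ∪ Y \ S := by
      ext t
      have := @hS t
      simp only [Finset.mem_sdiff, Finset.mem_insert, Finset.mem_erase, Finset.mem_union] at *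
      grind
    have hdisj : Disjoint ((S.erase y).erase z) (Y \ S) := by
      rw [Finset.disjoint_left]
      intro t ht ht'
      simp only [Finset.mem_sdiff, Finset.mem_erase] at *
      tauto
    have hA : ∏ t ∈ (S.erase y).erase z, (1 - z⁻¹ * t⁻¹) ≠ 0 := by
      refine Finset.prod_ne_zero_iff.2 fun t ht => hone' t ?_ ?_
      · exact hSne0 t (Finset.mem_of_mem_erase (Finset.mem_of_mem_erase ht))
      · rintro rfl
        exact hzS (Finset.mem_of_mem_erase (Finset.mem_of_mem_erase ht))
    rw [hYe, Finset.prod_union hdisj, Finset.prod_div_distrib]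
    by_cases hyS : y ∈ S
    · have h1 : insert y Y \ S = Y \ S := by
        rw [Finset.insert_sdiff_of_mem _ hyS]
      have h2 : S.erase z = insert y ((S.erase y).erase z) := by
        rw [Finset.erase_right_comm, Finset.insert_erase]
        exact Finset.mem_erase.2 ⟨hzy.symm, hyS⟩
      have h3 : 1 - z⁻¹ * y⁻¹ ≠ 0 := hone' y hy0 hziy.symm
      rw [h1, h2, Finset.prod_insert (by simp), if_pos hyS, mul_comm y⁻¹]
      simp only [Finset.prod_inv_distrib]
      generalize 1 - z⁻¹ * y⁻¹ = u at *
      generalize ∏ t ∈ (S.erase y).erase z, (1 - z⁻¹ * t⁻¹) = A at *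
      generalize ∏ t ∈ (S.erase y).erase z, (1 - t * z⁻¹) = B
      generalize ∏ t ∈ Y \ S, (1 - t * z⁻¹) = C
      field_simp
    · have h1 : insert y Y \ S = insert y (Y \ S) := Finset.insert_sdiff_of_notMem _ hyS
      have h3 : 1 - y * z⁻¹ ≠ 0 := hone y hzy.symm
      rw [h1, Finset.erase_eq_of_notMem hyS, Finset.prod_insert (by simp [hy]), if_neg hyS]
      rw [Finset.erase_eq_of_notMem hyS] at hA
      simp only [Finset.prod_inv_distrib]
      generalize 1 - y * z⁻¹ = u at *
      generalize ∏ t ∈ S.erase z, (1 - z⁻¹ * t⁻¹) = A at *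
      generalize ∏ t ∈ S.erase z, (1 - t * z⁻¹) = B
      generalize ∏ t ∈ Y \ S, (1 - t * z⁻¹) = C
      field_simp
  rw [hprod, hcore]
  ring

/-- The sum over all removals of a pair from a fixed term of `rectSum`. -/
theorem sum_rectSum_term_erase {Y : Finset F} {y : F} (h2 : (2 : F) ≠ 0) (hY0 : (0 : F) ∉ Y)
    (hYinv : ∀ z ∈ Y, z⁻¹ ∈ Y) (hYne : ∀ z ∈ Y, z ≠ z⁻¹) (hy0 : y ≠ 0) (hy : y ∉ Y)
    {S : Finset F} (hS : S ⊆ insert y Y) (m : ℤ) :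
    ∑ z ∈ (S.erase y).filter (fun z => z⁻¹ ∉ S),
      z ^ m * (∏ s ∈ Y.erase z, (1 - s * z⁻¹)⁻¹) *
      ∏ s ∈ S.erase z, (s ^ m *
        ∏ t ∈ insert y ((Y.erase z).erase z⁻¹) \ S.erase z, (1 - t * s⁻¹)⁻¹) =
    ∏ s ∈ S, (s ^ m * ∏ t ∈ insert y Y \ S, (1 - t * s⁻¹)⁻¹) -
      (if Even S.card then 1 else y) *
        ∏ s ∈ S, (s ^ (m - 1) * ∏ t ∈ insert y Y \ S, (1 - t * s⁻¹)⁻¹) := by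
  have hVY : ∀ z ∈ S.erase y, z ∈ Y := by
    intro z hz
    have := hS (Finset.mem_of_mem_erase hz)
    rw [Finset.mem_insert] at this
    exact this.resolve_left (Finset.ne_of_mem_erase hz)
  have hSne0 : ∀ s ∈ S, s ≠ 0 := by
    intro s hs h
    have := hS hs
    rw [Finset.mem_insert, h] at this
    rcases this with h | h
    · exact hy0 h.symm
    · exact hY0 h
  rw [Finset.sum_congr rfl fun z hz => rectSum_term_erase hY0 hYinv hy0 hy hS m
    (Finset.mem_filter.1 hz).1 (Finset.mem_filter.1 hz).2, ← Finset.mul_sum,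
    Finset.sum_filter_of_ne, sum_prod_one_sub_inv _ _ h2 (fun h => hY0 (hVY _ h))
      (fun h => hYne _ (hVY _ h) (by simp)) (fun h => hYne _ (hVY _ h) (by simp))]
  · have hshift : ∏ s ∈ S, (s ^ (m - 1) * ∏ t ∈ insert y Y \ S, (1 - t * s⁻¹)⁻¹) =
        (∏ s ∈ S, (s ^ m * ∏ t ∈ insert y Y \ S, (1 - t * s⁻¹)⁻¹)) * ∏ s ∈ S, s⁻¹ := by
      rw [← Finset.prod_mul_distrib]
      refine Finset.prod_congr rfl fun s hs => ?_
      rw [zpow_sub_one₀ (hSne0 s hs)]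
      ring
    rw [hshift]
    by_cases hyS : y ∈ S
    · rw [if_pos hyS, ← Finset.mul_prod_erase S (fun s => s⁻¹) hyS,
        ← Finset.card_erase_add_one hyS]
      by_cases he : Even (S.erase y).card
      · rw [if_pos he, if_neg (by simpa [Nat.even_add_one] using he)]
        linear_combination (∏ s ∈ S, (s ^ m * ∏ t ∈ insert y Y \ S, (1 - t * s⁻¹)⁻¹)) *
          (∏ t ∈ S.erase y, t⁻¹) * mul_inv_cancel₀ hy0
      · rw [if_neg he, if_pos (by simpa [Nat.even_add_one] using he)]
        ring
    · rw [if_neg hyS, Finset.erase_eq_of_notMem hyS]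
      ring
  · intro z hz hne hzi
    apply hne
    rw [Finset.prod_eq_zero (i := z⁻¹), mul_zero]
    · simp only [Finset.mem_erase]
      exact ⟨(hYne z (hVY z hz)).symm, fun h => hy (h ▸ hYinv z (hVY z hz)), hzi⟩
    · have hz0 : z ≠ 0 := hSne0 z (Finset.mem_of_mem_erase hz)
      simp [hz0]

/-- The recursion for rectangular Schur polynomials in inverse pairs of variables `Y` and one
further variable `y`. -/
theorem rectSum_succ {Y : Finset F} {y : F} (h2 : (2 : F) ≠ 0) (hY0 : (0 : F) ∉ Y)
    (hYinv : ∀ z ∈ Y, z⁻¹ ∈ Y) (hYne : ∀ z ∈ Y, z ≠ z⁻¹) (hy0 : y ≠ 0) (hy : y ∉ Y)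
    (n : ℕ) (m : ℤ) :
    rectSum (insert y Y) (n + 1) m =
      (if Even (n + 1) then 1 else y) * rectSum (insert y Y) (n + 1) (m - 1) +
      ∑ z ∈ Y, z ^ m * (∏ s ∈ Y.erase z, (1 - s * z⁻¹)⁻¹) *
        rectSum (insert y ((Y.erase z).erase z⁻¹)) n m := by
  rw [← sub_eq_iff_eq_add']
  simp only [rectSum, Finset.mul_sum]
  rw [← Finset.sum_sub_distrib]
  have hterm : ∀ S ∈ (insert y Y).powersetCard (n + 1), _ := fun S hS =>
    sum_rectSum_term_erase h2 hY0 hYinv hYne hy0 hy (Finset.mem_powersetCard.1 hS).1 m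
  rw [Finset.sum_congr rfl fun S hS => by
    rw [← (Finset.mem_powersetCard.1 hS).2, ← hterm S hS]]
  rw [Finset.sum_sigma', Finset.sum_sigma']
  refine Finset.sum_bij' (fun p _ => ⟨p.2, p.1.erase p.2⟩) (fun p _ => ⟨insert p.1 p.2, p.1⟩)
    ?_ ?_ ?_ ?_ ?_
  · rintro ⟨S, z⟩ h
    simp only [Finset.mem_sigma, Finset.mem_powersetCard, Finset.mem_filter,
      Finset.mem_erase] at h ⊢
    obtain ⟨⟨hS, hc⟩, ⟨hzy, hz⟩, hzi⟩ := h
    have hzY : z ∈ Y := by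
      have := hS hz
      rw [Finset.mem_insert] at this
      tauto
    refine ⟨hzY, fun t ht => ?_, by rw [Finset.card_erase_of_mem hz, hc]; rfl⟩
    have := @hS t
    simp only [Finset.mem_insert, Finset.mem_erase] at *
    grind
  · rintro ⟨z, S⟩ h
    simp only [Finset.mem_sigma, Finset.mem_powersetCard] at h
    obtain ⟨hz, hS, hc⟩ := h
    have hzy : z ≠ y := fun h => hy (h ▸ hz)
    have hziy : z⁻¹ ≠ y := fun h => hy (h ▸ hYinv z hz)
    have hzS : z ∉ S := fun h => by simpa [hzy] using hS h
    have hziS : z⁻¹ ∉ S := fun h => by simpa [hziy] using hS h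
    simp only [Finset.mem_sigma, Finset.mem_powersetCard, Finset.mem_filter,
      Finset.mem_erase, Finset.mem_insert]
    refine ⟨⟨?_, by rw [Finset.card_insert_of_notMem hzS, hc]⟩, ⟨hzy, by simp⟩, ?_⟩
    · intro t ht
      have := @hS t
      simp only [Finset.mem_insert, Finset.mem_erase] at *
      grind
    · rintro (h | h)
      · exact hYne z hz h.symm
      · exact hziS h
  · rintro ⟨S, z⟩ h
    simp only [Finset.mem_sigma, Finset.mem_filter, Finset.mem_erase] at h
    simp [Finset.insert_erase h.2.1.2]
  · rintro ⟨z, S⟩ h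
    simp only [Finset.mem_sigma, Finset.mem_powersetCard] at h
    have hzy : z ≠ y := fun e => hy (e ▸ h.1)
    have hzS : z ∉ S := fun e => by simpa [hzy] using h.2.1 e
    simp [Finset.erase_insert hzS]
  · rintro ⟨S, z⟩ h
    rfl

end RectangularSum

section Laplace

theorem det_zpow_sub_sub {N : ℕ} (z : Fin N → F) :
    (Matrix.of fun i j : Fin N => z j ^ ((N : ℤ) - 1 - (i : ℕ))).det =
      ∏ i, ∏ j, if i < j then z i - z j else 1 := by
  have : (Matrix.of fun i j : Fin N => z j ^ ((N : ℤ) - 1 - (i : ℕ))) =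
      (Matrix.projVandermonde 1 z)ᵀ := by
    ext i j
    simp only [Matrix.of_apply, Matrix.transpose_apply, Matrix.projVandermonde_apply, Pi.one_apply,
      one_pow, one_mul]
    rw [← zpow_natCast, Fin.val_rev]
    congr 1
    have := i.isLt
    omega
  rw [this, Matrix.det_transpose, Matrix.det_projVandermonde]
  refine Finset.prod_congr rfl fun i _ => ?_
  rw [← Finset.prod_filter]
  refine Finset.prod_congr ?_ fun j _ => by simp
  ext j
  simp

theorem det_zpow_blocks {p q : ℕ} (z : Fin (p + q) → F) (h0 : ∀ j, z j ≠ 0)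
    (hz : Function.Injective z) :
    (Matrix.of fun i j : Fin (p + q) => if ((i : ℕ) < p ↔ (j : ℕ) < p) then
      z j ^ (((p + q : ℕ) : ℤ) - 1 - (i : ℕ)) else 0).det =
    (∏ i : Fin p, ∏ j : Fin q, (1 - z (Fin.natAdd p j) * (z (Fin.castAdd q i))⁻¹)⁻¹) *
      (Matrix.of fun i j : Fin (p + q) => z j ^ (((p + q : ℕ) : ℤ) - 1 - (i : ℕ))).det := by
  rw [← Matrix.det_submatrix_equiv_self finSumFinEquiv]
  have hblock : (Matrix.of fun i j : Fin (p + q) => if ((i : ℕ) < p ↔ (j : ℕ) < p) then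
      z j ^ (((p + q : ℕ) : ℤ) - 1 - (i : ℕ)) else 0).submatrix finSumFinEquiv finSumFinEquiv =
      Matrix.fromBlocks
        (Matrix.of fun i j : Fin p => z (Fin.castAdd q j) ^ q *
          (Matrix.of fun i j : Fin p => z (Fin.castAdd q j) ^ ((p : ℤ) - 1 - (i : ℕ))) i j) 0 0
        (Matrix.of fun i j : Fin q => z (Fin.natAdd p j) ^ ((q : ℤ) - 1 - (i : ℕ))) := by
    ext (i | i) (j | j)
    · have := i.isLt
      have := j.isLt
      simp only [Matrix.submatrix_apply, finSumFinEquiv_apply_left, Matrix.of_apply,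
        Matrix.fromBlocks_apply₁₁, Fin.val_castAdd, Fin.is_lt]
      rw [if_pos trivial, ← zpow_natCast, ← zpow_add₀ (h0 _)]
      congr 1
      push_cast
      ring
    · simp
    · simp
    · simp only [Matrix.submatrix_apply, finSumFinEquiv_apply_right, Matrix.of_apply,
        Matrix.fromBlocks_apply₂₂, Fin.val_natAdd]
      rw [if_pos (by simp)]
      congr 1
      push_cast
      ring
  rw [hblock, Matrix.det_fromBlocks_zero₂₁, Matrix.det_mul_row, det_zpow_sub_sub,
    det_zpow_sub_sub, det_zpow_sub_sub]
  simp only [Fin.prod_univ_add]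
  have e1 : ∀ i j : Fin p, (Fin.castAdd q i < Fin.castAdd q j) = (i < j) := fun i j =>
    propext (by rw [Fin.lt_def, Fin.lt_def]; rfl)
  have e2 : ∀ i j : Fin q, (Fin.natAdd p i < Fin.natAdd p j) = (i < j) := fun i j =>
    propext (by rw [Fin.lt_def, Fin.lt_def, Fin.val_natAdd, Fin.val_natAdd]; omega)
  have e3 : ∀ (i : Fin p) (j : Fin q), Fin.castAdd q i < Fin.natAdd p j := fun i j => by
    rw [Fin.lt_def, Fin.val_castAdd, Fin.val_natAdd]
    omega
  have e4 : ∀ (i : Fin p) (j : Fin q), ¬ Fin.natAdd p j < Fin.castAdd q i := fun i j => by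
    rw [Fin.lt_def, Fin.val_castAdd, Fin.val_natAdd]
    omega
  simp only [e1, e2, e3, e4, if_true, if_false, Finset.prod_const_one, one_mul,
    Finset.prod_mul_distrib]
  have hcross : ∏ i : Fin p, z (Fin.castAdd q i) ^ q =
      (∏ i : Fin p, ∏ j : Fin q, (1 - z (Fin.natAdd p j) * (z (Fin.castAdd q i))⁻¹)⁻¹) *
        ∏ i : Fin p, ∏ j : Fin q, (z (Fin.castAdd q i) - z (Fin.natAdd p j)) := by
    rw [← Finset.prod_mul_distrib]
    refine Finset.prod_congr rfl fun i _ => ?_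
    rw [← Finset.prod_mul_distrib]
    have : ∀ j : Fin q, (1 - z (Fin.natAdd p j) * (z (Fin.castAdd q i))⁻¹)⁻¹ *
        (z (Fin.castAdd q i) - z (Fin.natAdd p j)) = z (Fin.castAdd q i) := by
      intro j
      have h1 := h0 (Fin.castAdd q i)
      have h2 : z (Fin.castAdd q i) - z (Fin.natAdd p j) ≠ 0 :=
        sub_ne_zero.2 fun h => (e3 i j).ne (hz h)
      field_simp
    simp [this]
  rw [hcross]
  ring

/-- A determinant whose columns in `S` live in the first `n` rows and whose other columns live in
the remaining rows vanishes unless `S` has `n` elements. -/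
theorem det_eq_zero_of_card_ne {N n : ℕ} (hn : n ≤ N) (S : Finset (Fin N)) (hS : S.card ≠ n)
    (A : Matrix (Fin N) (Fin N) F) (hA : ∀ i j : Fin N, ¬ ((i : ℕ) < n ↔ j ∈ S) → A i j = 0) :
    A.det = 0 := by
  rw [Matrix.det_apply]
  refine Finset.sum_eq_zero fun σ _ => ?_
  have : ∃ j, ¬ ((σ j : ℕ) < n ↔ j ∈ S) := by
    by_contra! h
    apply hS
    have h1 : S.map σ.toEmbedding = Finset.univ.filter (fun i : Fin N => (i : ℕ) < n) := by
      ext i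
      simp only [Finset.mem_map_equiv, Finset.mem_filter, Finset.mem_univ, true_and]
      rw [← h]
      simp
    rw [← Finset.card_map σ.toEmbedding, h1, Fin.card_filter_val_lt, min_eq_right hn]
  obtain ⟨j, hj⟩ := this
  rw [Finset.prod_eq_zero (f := fun i => A (σ i) i) (Finset.mem_univ j) (hA _ _ hj), smul_zero]

theorem det_zpow_piecewise {N n : ℕ} (hn : n ≤ N) (z : Fin N → F) (h0 : ∀ j, z j ≠ 0)
    (hz : Function.Injective z) (S : Finset (Fin N)) (hS : S.card = n) :
    (Matrix.of fun i j : Fin N => if ((i : ℕ) < n ↔ j ∈ S) then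
      z j ^ ((N : ℤ) - 1 - (i : ℕ)) else 0).det =
    (∏ s ∈ S, ∏ t ∈ Sᶜ, (1 - z t * (z s)⁻¹)⁻¹) *
      (Matrix.of fun i j : Fin N => z j ^ ((N : ℤ) - 1 - (i : ℕ))).det := by
  obtain ⟨q, rfl⟩ := Nat.exists_eq_add_of_le hn
  have hcard : Fintype.card {i : Fin (n + q) // (i : ℕ) < n} =
      Fintype.card {j : Fin (n + q) // j ∈ S} := by
    rw [Fintype.card_subtype, Fin.card_filter_val_lt, Fintype.card_coe, hS]
    simp
  set σ : Equiv.Perm (Fin (n + q)) := (Fintype.equivOfCardEq hcard).extendSubtype with hσ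
  have hmem : ∀ i, σ i ∈ S ↔ (i : ℕ) < n := fun i =>
    ⟨fun h => by
      by_contra hi
      exact (Fintype.equivOfCardEq hcard).extendSubtype_not_mem i hi h,
     fun h => (Fintype.equivOfCardEq hcard).extendSubtype_mem i h⟩
  have key := det_zpow_blocks (z ∘ σ) (fun j => h0 _) (hz.comp σ.injective)
  have e1 : (Matrix.of fun i j : Fin (n + q) => if ((i : ℕ) < n ↔ (j : ℕ) < n) then
      (z ∘ σ) j ^ (((n + q : ℕ) : ℤ) - 1 - (i : ℕ)) else 0) =
      (Matrix.of fun i j : Fin (n + q) => if ((i : ℕ) < n ↔ j ∈ S) then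
      z j ^ (((n + q : ℕ) : ℤ) - 1 - (i : ℕ)) else 0).submatrix id σ := by
    ext i j
    simp [hmem]
  have e2 : (Matrix.of fun i j : Fin (n + q) => (z ∘ σ) j ^ (((n + q : ℕ) : ℤ) - 1 - (i : ℕ))) =
      (Matrix.of fun i j : Fin (n + q) => z j ^ (((n + q : ℕ) : ℤ) - 1 - (i : ℕ))).submatrix
        id σ := rfl
  rw [e1, e2, Matrix.det_permute', Matrix.det_permute'] at key
  have hmap1 : S = (Finset.univ : Finset (Fin n)).image fun i => σ (Fin.castAdd q i) := by
    ext s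
    simp only [Finset.mem_image, Finset.mem_univ, true_and]
    constructor
    · intro h
      obtain ⟨i, rfl⟩ := σ.surjective s
      exact ⟨⟨i, (hmem i).1 h⟩, by congr⟩
    · rintro ⟨i, rfl⟩
      simp [hmem]
  have hmap2 : Sᶜ = (Finset.univ : Finset (Fin q)).image fun i => σ (Fin.natAdd n i) := by
    ext s
    simp only [Finset.mem_image, Finset.mem_univ, true_and, Finset.mem_compl]
    constructor
    · intro h
      obtain ⟨i, rfl⟩ := σ.surjective s
      rw [hmem] at h
      refine ⟨⟨i - n, by have := i.isLt; omega⟩, ?_⟩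
      congr 1
      ext
      simp
      omega
    · rintro ⟨i, rfl⟩
      simp [hmem]
  have hprod : ∏ s ∈ S, ∏ t ∈ Sᶜ, (1 - z t * (z s)⁻¹)⁻¹ =
      ∏ i : Fin n, ∏ j : Fin q, (1 - (z ∘ σ) (Fin.natAdd n j) *
        ((z ∘ σ) (Fin.castAdd q i))⁻¹)⁻¹ := by
    rw [hmap2]
    conv_lhs => rw [hmap1]
    rw [Finset.prod_image fun a _ b _ h => Fin.castAdd_injective _ _ (σ.injective h)]
    refine Finset.prod_congr rfl fun i _ => ?_
    rw [Finset.prod_image fun a _ b _ h => Fin.natAdd_injective _ _ (σ.injective h)]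
    rfl
  rw [hprod]
  have hsign : ((Equiv.Perm.sign σ : ℤˣ) : F) ≠ 0 := by
    rcases Int.units_eq_one_or (Equiv.Perm.sign σ) with h | h <;> simp [h]
  apply mul_left_cancel₀ hsign
  rw [key]
  ring

theorem det_zpow_ne_zero {N : ℕ} (z : Fin N → F) (hz : Function.Injective z) :
    (Matrix.of fun i j : Fin N => z j ^ ((N : ℤ) - 1 - (i : ℕ))).det ≠ 0 := by
  rw [det_zpow_sub_sub]
  refine Finset.prod_ne_zero_iff.2 fun i _ => Finset.prod_ne_zero_iff.2 fun j _ => ?_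
  split_ifs with h
  · exact sub_ne_zero.2 fun e => h.ne (hz e)
  · exact one_ne_zero

theorem schurP_rectangle {N n : ℕ} (hn : n ≤ N) (z : Fin N → F) (h0 : ∀ j, z j ≠ 0)
    (hz : Function.Injective z) (m : ℤ) :
    schurP z (fun j => if (j : ℕ) < n then m else 0) = rectSum (Finset.univ.image z) n m := by
  rw [schurP, div_eq_iff (det_zpow_ne_zero z hz)]
  rw [← Matrix.det_transpose]
  set a : Fin N → Fin N → F := fun j i =>
    if (i : ℕ) < n then z j ^ m * z j ^ ((N : ℤ) - 1 - (i : ℕ)) else 0 with ha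
  set b : Fin N → Fin N → F := fun j i =>
    if (i : ℕ) < n then 0 else z j ^ ((N : ℤ) - 1 - (i : ℕ)) with hb
  have hab : (Matrix.of fun i j : Fin N =>
      z j ^ ((if (i : ℕ) < n then m else 0) + (N : ℤ) - 1 - (i : ℕ)))ᵀ = a + b := by
    ext j i
    simp only [ha, hb, Matrix.transpose_apply, Matrix.of_apply, Pi.add_apply]
    split_ifs
    · rw [← zpow_add₀ (h0 j), add_zero]
      congr 1
      ring
    · rw [zero_add, zero_add]
  have hadd : Matrix.det (a + b) = ∑ S : Finset (Fin N), Matrix.det (S.piecewise a b) :=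
    (Matrix.detRowAlternating (n := Fin N) (R := F)).map_add_univ a b
  rw [hab, hadd]
  have hpw : ∀ S : Finset (Fin N), Matrix.det (S.piecewise a b) = (∏ s ∈ S, z s ^ m) *
      (Matrix.of fun i j : Fin N => if ((i : ℕ) < n ↔ j ∈ S) then
        z j ^ ((N : ℤ) - 1 - (i : ℕ)) else 0).det := by
    intro S
    have : (∏ s ∈ S, z s ^ m) = ∏ j, if j ∈ S then z j ^ m else 1 := by simp
    rw [this, ← Matrix.det_mul_row, ← Matrix.det_transpose]
    congr 1
    ext i j
    rw [Matrix.transpose_apply, Matrix.of_apply, Matrix.of_apply]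
    by_cases h1 : i ∈ S <;> by_cases h2 : (j : ℕ) < n <;> simp [Finset.piecewise, ha, hb, h1, h2]
  have hz' : (Finset.univ.image z).powersetCard n =
      ((Finset.univ : Finset (Fin N)).powersetCard n).image (Finset.image z) := by
    rw [show z = (⟨z, hz⟩ : Fin N ↪ F) from rfl, ← Finset.map_eq_image, Finset.powersetCard_map]
    ext S
    simp [Finset.map_eq_image]
  rw [rectSum, hz', Finset.sum_image fun S _ T _ h => Finset.image_injective hz h,
    Finset.sum_mul]
  rw [← Finset.sum_subset (Finset.subset_univ ((Finset.univ : Finset (Fin N)).powersetCard n))]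
  · refine Finset.sum_congr rfl fun S hS => ?_
    rw [hpw, det_zpow_piecewise hn z h0 hz S (Finset.mem_powersetCard.1 hS).2]
    rw [Finset.prod_image fun a _ b _ h => hz h, Finset.prod_mul_distrib, ← mul_assoc]
    congr 2
    refine Finset.prod_congr rfl fun s _ => ?_
    rw [← Finset.image_sdiff _ _ hz, Finset.prod_image fun a _ b _ h => hz h,
      Finset.compl_eq_univ_sdiff]
  · intro S _ hS
    rw [hpw, det_eq_zero_of_card_ne hn S (fun h => hS (Finset.mem_powersetCard.2
      ⟨Finset.subset_univ _, h⟩)), mul_zero]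
    intro i j h
    simp [h]

/-- The rectangle of width `-1` has two equal exponents. -/
theorem rectSum_neg_one {N n : ℕ} (hn : n < N) (h1 : 0 < n) (z : Fin N → F) (h0 : ∀ j, z j ≠ 0)
    (hz : Function.Injective z) : rectSum (Finset.univ.image z) n (-1) = 0 := by
  rw [← schurP_rectangle hn.le z h0 hz, schurP, div_eq_zero_iff]
  left
  refine Matrix.det_zero_of_row_eq (i := ⟨n - 1, by omega⟩) (j := ⟨n, hn⟩) (by simp; omega) ?_
  ext j
  simp only [Matrix.of_apply, lt_irrefl, if_false, if_pos (Nat.sub_lt h1 one_pos)]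
  congr 1
  push_cast [h1]
  ring

theorem rectSum_zero {N n : ℕ} (hn : n ≤ N) (z : Fin N → F) (h0 : ∀ j, z j ≠ 0)
    (hz : Function.Injective z) : rectSum (Finset.univ.image z) n 0 = 1 := by
  rw [← schurP_rectangle hn z h0 hz, schurP]
  simp only [ite_self, zero_add]
  exact div_self (det_zpow_ne_zero z hz)

end Laplace

section ColumnParity

/-- Partitions inside the rectangle `(m^n)` all of whose column lengths are congruent to `n`
modulo two. -/
def columnParityPartitions (m n : ℕ) : Finset (Fin n → ℕ) :=
  (Fintype.piFinset fun _ => Finset.range (m + 1)).filter fun lam => Antitone lam ∧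
    ∀ c : ℕ, 1 ≤ c → c ≤ m →
      (Even (Finset.univ.filter (fun j : Fin n => c ≤ lam j)).card ↔ Even n)

theorem mem_columnParityPartitions {m n : ℕ} {lam : Fin n → ℕ} :
    lam ∈ columnParityPartitions m n ↔ (∀ i, lam i ≤ m) ∧ Antitone lam ∧
      ∀ c : ℕ, 1 ≤ c → c ≤ m →
        (Even (Finset.univ.filter (fun j : Fin n => c ≤ lam j)).card ↔ Even n) := by
  simp [columnParityPartitions]

theorem antitone_cons_iff {n : ℕ} {a : ℕ} {t : Fin n → ℕ} :
    Antitone (Fin.cons a t : Fin (n + 1) → ℕ) ↔ (∀ i, t i ≤ a) ∧ Antitone t := by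
  constructor
  · intro h
    refine ⟨fun i => ?_, fun i j hij => ?_⟩
    · simpa using h (Fin.zero_le i.succ)
    · simpa using h (Fin.succ_le_succ_iff.2 hij)
  · rintro ⟨h1, h2⟩ i j hij
    induction i using Fin.cases with
    | zero =>
      induction j using Fin.cases with
      | zero => exact le_rfl
      | succ j => simpa using h1 j
    | succ i =>
      induction j using Fin.cases with
      | zero => exact absurd hij (not_le.2 (Fin.succ_pos i))
      | succ j => simpa using h2 (Fin.succ_le_succ_iff.1 hij)

theorem card_filter_le_cons {n : ℕ} (c a : ℕ) (t : Fin n → ℕ) :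
    (Finset.univ.filter fun j => c ≤ (Fin.cons a t : Fin (n + 1) → ℕ) j).card =
      (if c ≤ a then 1 else 0) + (Finset.univ.filter fun j => c ≤ t j).card := by
  rw [Fin.card_filter_univ_succ]
  simp only [Fin.cons_zero, Fin.cons_succ]
  split_ifs <;> omega

theorem cons_mem_columnParityPartitions {m n : ℕ} {t : Fin n → ℕ} :
    (Fin.cons m t : Fin (n + 1) → ℕ) ∈ columnParityPartitions m (n + 1) ↔
      t ∈ columnParityPartitions m n := by
  simp only [mem_columnParityPartitions, antitone_cons_iff, Fin.forall_fin_succ, Fin.cons_zero,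
    Fin.cons_succ, le_refl, true_and, card_filter_le_cons]
  have : ∀ c ≤ m, ∀ u : ℕ, ((Even ((if c ≤ m then 1 else 0) + u) ↔ Even (n + 1)) ↔
      (Even u ↔ Even n)) := by
    intro c hc u
    rw [if_pos hc, add_comm, Nat.even_add_one, Nat.even_add_one]
    tauto
  constructor
  · rintro ⟨h1, ⟨_, h2⟩, h3⟩
    exact ⟨h1, h2, fun c hc hcm => (this c hcm _).1 (h3 c hc hcm)⟩
  · rintro ⟨h1, h2, h3⟩
    exact ⟨h1, ⟨h1, h2⟩, fun c hc hcm => (this c hcm _).2 (h3 c hc hcm)⟩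

theorem columnParityPartitions_head_eq {m n : ℕ} (hn : Even n) {lam : Fin (n + 1) → ℕ}
    (h : lam ∈ columnParityPartitions m (n + 1)) : lam 0 = m := by
  rw [mem_columnParityPartitions] at h
  obtain ⟨h1, h2, h3⟩ := h
  by_contra hne
  have hlt : lam 0 < m := lt_of_le_of_ne (h1 0) hne
  have h4 := h3 m (by omega) le_rfl
  rw [Finset.filter_false_of_mem fun j _ => not_le.2 ((h2 (Fin.zero_le j)).trans_lt hlt)] at h4
  simp [Nat.even_add_one, hn] at h4

theorem mem_columnParityPartitions_succ_iff {m n : ℕ} (hn : Even n) {lam : Fin n → ℕ}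
    (hlam : ∀ i, lam i ≤ m) :
    lam ∈ columnParityPartitions (m + 1) n ↔ lam ∈ columnParityPartitions m n := by
  simp only [mem_columnParityPartitions]
  constructor
  · rintro ⟨_, h2, h3⟩
    exact ⟨hlam, h2, fun c hc hcm => h3 c hc (by omega)⟩
  · rintro ⟨h1, h2, h3⟩
    refine ⟨fun i => (h1 i).trans (by omega), h2, fun c hc hcm => ?_⟩
    rcases Nat.lt_or_ge m c with h | h
    · rw [Finset.filter_false_of_mem fun j _ => not_le.2 ((h1 j).trans_lt h)]
      simp [hn]
    · exact h3 c hc h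

theorem sum_columnParityPartitions_filter {m n : ℕ} (f : (Fin (n + 1) → ℕ) → F) :
    ∑ lam ∈ (columnParityPartitions m (n + 1)).filter (fun lam => lam 0 = m), f lam =
      ∑ t ∈ columnParityPartitions m n, f (Fin.cons m t) := by
  symm
  refine Finset.sum_bij' (fun t _ => Fin.cons m t) (fun lam _ => Fin.tail lam) ?_ ?_ ?_ ?_ ?_
  · intro t ht
    simp [cons_mem_columnParityPartitions, ht]
  · intro lam h
    rw [Finset.mem_filter] at h
    rw [← cons_mem_columnParityPartitions, ← h.2, Fin.cons_self_tail, h.2]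
    exact h.1
  · intro t _
    simp
  · intro lam h
    rw [Finset.mem_filter] at h
    rw [← h.2, Fin.cons_self_tail]
  · intro _ _
    rfl

theorem sum_columnParityPartitions_of_even {m n : ℕ} (hn : Even n) (f : (Fin (n + 1) → ℕ) → F) :
    ∑ lam ∈ columnParityPartitions m (n + 1), f lam =
      ∑ t ∈ columnParityPartitions m n, f (Fin.cons m t) := by
  rw [← sum_columnParityPartitions_filter, Finset.filter_true_of_mem fun lam h =>
    columnParityPartitions_head_eq hn h]

theorem sum_columnParityPartitions_zero {n : ℕ} (f : (Fin (n + 1) → ℕ) → F) :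
    ∑ lam ∈ columnParityPartitions 0 (n + 1), f lam =
      ∑ t ∈ columnParityPartitions 0 n, f (Fin.cons 0 t) := by
  rw [← sum_columnParityPartitions_filter, Finset.filter_true_of_mem fun lam h =>
    Nat.le_zero.1 ((mem_columnParityPartitions.1 h).1 0)]

theorem sum_columnParityPartitions_of_odd {m n : ℕ} (hn : Even (n + 1))
    (f : (Fin (n + 1) → ℕ) → F) :
    ∑ lam ∈ columnParityPartitions (m + 1) (n + 1), f lam =
      ∑ lam ∈ columnParityPartitions m (n + 1), f lam +
      ∑ t ∈ columnParityPartitions (m + 1) n, f (Fin.cons (m + 1) t) := by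
  rw [← sum_columnParityPartitions_filter,
    add_comm (∑ lam ∈ columnParityPartitions m (n + 1), f lam),
    ← Finset.sum_filter_add_sum_filter_not _ (fun lam => lam 0 = m + 1)]
  congr 2
  ext lam
  rw [Finset.mem_filter]
  constructor
  · rintro ⟨h1, h2⟩
    have h := mem_columnParityPartitions.1 h1
    refine (mem_columnParityPartitions_succ_iff hn fun i => ?_).1 h1
    have := h.1 0
    have := h.2.1 (Fin.zero_le i)
    omega
  · intro h1
    have h := (mem_columnParityPartitions.1 h1).1
    exact ⟨(mem_columnParityPartitions_succ_iff hn h).2 h1, by have := h 0; omega⟩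

theorem columnParityPartitions_zero (n : ℕ) : columnParityPartitions 0 n = {0} := by
  ext lam
  rw [mem_columnParityPartitions, Finset.mem_singleton]
  constructor
  · rintro ⟨h, -⟩
    ext i
    simpa using h i
  · rintro rfl
    exact ⟨fun _ => le_rfl, fun _ _ _ => le_rfl, fun c h1 h2 => by omega⟩

end ColumnParity

section InterDet

/-- A row, with exponent `a`, of the matrix defining the intermediate symplectic characters
with one ordinary variable `y`. -/
def interRow {k : ℕ} (x : Fin k → F) (y : F) (a : ℤ) : Fin (k + 1) → F :=
  Fin.snoc (α := fun _ => F)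
    (fun j => x j ^ a / (1 - (x j)⁻¹ * y) - x j ^ (-a) / (1 - x j * y)) (y ^ a)

/-- The determinant of the matrix with rows `interRow x y (a i)`. -/
def interDet {k : ℕ} (x : Fin k → F) (y : F) (a : Fin (k + 1) → ℤ) : F :=
  (Matrix.of fun i => interRow x y (a i)).det

/-- The sum of the numerators of the intermediate symplectic characters over the partitions in
`columnParityPartitions m (k + 1)`. -/
def interSum {k : ℕ} (x : Fin k → F) (y : F) (m : ℕ) : F :=
  ∑ lam ∈ columnParityPartitions m (k + 1), interDet x y fun i => (lam i : ℤ) + k - (i : ℕ)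

theorem interRow_sub {k : ℕ} (x : Fin k → F) (y : F) (h0 : ∀ j, x j ≠ 0) (hy0 : y ≠ 0)
    (hxy : ∀ j, x j ≠ y) (hxy1 : ∀ j, x j * y ≠ 1) (a : ℤ) (j : Fin (k + 1)) :
    interRow x y a j - y * interRow x y (a - 1) j =
      Fin.snoc (α := fun _ => F) (fun j => x j ^ a - x j ^ (-a)) 0 j := by
  induction j using Fin.lastCases with
  | last =>
    simp only [interRow, Fin.snoc_last]
    rw [zpow_sub_one₀ hy0]
    field_simp
    ring
  | cast j =>
    simp only [interRow, Fin.snoc_castSucc]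
    have h1 : 1 - (x j)⁻¹ * y ≠ 0 := by
      intro h
      apply hxy j
      linear_combination x j * h + y * mul_inv_cancel₀ (h0 j)
    have h2 : 1 - x j * y ≠ 0 := sub_ne_zero.2 (hxy1 j).symm
    rw [show -(a - 1) = -a + 1 by ring, zpow_sub_one₀ (h0 j), zpow_add_one₀ (h0 j)]
    generalize x j ^ (-a) = v
    generalize x j ^ a = u
    rw [← sub_eq_zero]
    have : u / (1 - (x j)⁻¹ * y) - v / (1 - x j * y) -
        y * (u * (x j)⁻¹ / (1 - (x j)⁻¹ * y) - v * x j / (1 - x j * y)) - (u - v) =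
        u * ((1 - (x j)⁻¹ * y) / (1 - (x j)⁻¹ * y) - 1) -
          v * ((1 - x j * y) / (1 - x j * y) - 1) := by ring
    rw [this, div_self h1, div_self h2]
    ring

theorem interDet_minor {k : ℕ} (x : Fin (k + 1) → F) (y : F) (M : ℤ) (a : Fin (k + 1) → ℤ)
    (j : Fin (k + 1)) :
    ((Matrix.of fun i => interRow x y ((Fin.cons M a : Fin (k + 2) → ℤ) i)).submatrix Fin.succ
      j.castSucc.succAbove).det = interDet (x ∘ j.succAbove) y a := by
  rw [interDet]
  congr 1
  ext i l
  rw [Matrix.submatrix_apply, Matrix.of_apply, Matrix.of_apply, Fin.cons_succ]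
  induction l using Fin.lastCases with
  | last => simp [interRow]
  | cast l => simp [interRow, Fin.castSucc_succAbove_castSucc]

theorem interDet_cons {k : ℕ} (x : Fin (k + 1) → F) (y : F) (h0 : ∀ j, x j ≠ 0) (hy0 : y ≠ 0)
    (hxy : ∀ j, x j ≠ y) (hxy1 : ∀ j, x j * y ≠ 1) (M : ℤ) (a : Fin (k + 1) → ℤ) :
    interDet x y (Fin.cons M a) = y * interDet x y (Fin.cons (M - 1) a) +
      ∑ j : Fin (k + 1), (-1) ^ (j : ℕ) * (x j ^ M - x j ^ (-M)) *
        interDet (x ∘ j.succAbove) y a := by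
  rw [← sub_eq_iff_eq_add', interDet, interDet, Matrix.det_succ_row_zero,
    Matrix.det_succ_row_zero, Finset.mul_sum, ← Finset.sum_sub_distrib]
  have hminor : ∀ j : Fin (k + 2),
      (Matrix.of fun i => interRow x y ((Fin.cons (M - 1) a : Fin (k + 2) → ℤ) i)).submatrix
        Fin.succ j.succAbove =
      (Matrix.of fun i => interRow x y ((Fin.cons M a : Fin (k + 2) → ℤ) i)).submatrix
        Fin.succ j.succAbove := fun j => by
    ext i l
    simp
  have hterm : ∀ j : Fin (k + 2), _ := fun j => interRow_sub x y h0 hy0 hxy hxy1 M j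
  have : ∀ j : Fin (k + 2), ∀ e r s d : F, e * r * d - y * (e * s * d) = e * (r - y * s) * d :=
    fun _ _ _ _ _ => by ring
  simp only [hminor, Matrix.of_apply, Fin.cons_zero, this 0, hterm]
  rw [Fin.sum_univ_castSucc]
  simp only [Fin.snoc_last, mul_zero, zero_mul, add_zero, Fin.snoc_castSucc, Fin.val_castSucc,
    interDet_minor]

theorem interDet_cons_eq_zero {k : ℕ} (x : Fin (k + 1) → F) (y : F) (a : Fin (k + 1) → ℤ) :
    interDet x y (Fin.cons (a 0) a) = 0 := by
  refine Matrix.det_zero_of_row_eq (i := 0) (j := 1) (by simp) ?_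
  change interRow x y ((Fin.cons (a 0) a : Fin (k + 2) → ℤ) 0) =
    interRow x y ((Fin.cons (a 0) a : Fin (k + 2) → ℤ) (Fin.succ 0))
  rw [Fin.cons_zero, Fin.cons_succ]

theorem cons_shift {k : ℕ} (m : ℕ) (t : Fin (k + 1) → ℕ) :
    (fun i : Fin (k + 2) => (((Fin.cons m t : Fin (k + 2) → ℕ) i : ℕ) : ℤ) + ((k + 1 : ℕ) : ℤ) -
      (i : ℕ)) = Fin.cons ((m : ℤ) + ((k + 1 : ℕ) : ℤ)) fun i => (t i : ℤ) + k - (i : ℕ) := by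
  ext i
  induction i using Fin.cases with
  | zero => simp
  | succ i =>
    simp
    ring

/-- The contribution of the partitions of maximal width to `interSum`. -/
theorem sum_interDet_cons {k : ℕ} (x : Fin (k + 1) → F) (y : F) (h0 : ∀ j, x j ≠ 0) (hy0 : y ≠ 0)
    (hxy : ∀ j, x j ≠ y) (hxy1 : ∀ j, x j * y ≠ 1) (m : ℕ) :
    ∑ t ∈ columnParityPartitions m (k + 1),
        interDet x y (Fin.cons ((m : ℤ) + ((k + 1 : ℕ) : ℤ)) fun i => (t i : ℤ) + k - (i : ℕ)) =
      y * ∑ t ∈ columnParityPartitions m (k + 1),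
        interDet x y (Fin.cons ((m : ℤ) + k) fun i => (t i : ℤ) + k - (i : ℕ)) +
      ∑ j : Fin (k + 1), (-1) ^ (j : ℕ) *
        (x j ^ ((m : ℤ) + ((k + 1 : ℕ) : ℤ)) - x j ^ (-((m : ℤ) + ((k + 1 : ℕ) : ℤ)))) *
          interSum (x ∘ j.succAbove) y m := by
  simp only [interSum, Finset.mul_sum]
  rw [Finset.sum_comm, ← Finset.sum_add_distrib]
  refine Finset.sum_congr rfl fun t _ => ?_
  rw [interDet_cons x y h0 hy0 hxy hxy1, show (m : ℤ) + ((k + 1 : ℕ) : ℤ) - 1 = m + k by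
    push_cast; ring]

theorem interDet_cons_head {k : ℕ} (x : Fin (k + 1) → F) (y : F) {m : ℕ} {t : Fin (k + 1) → ℕ}
    (ht : t 0 = m) :
    interDet x y (Fin.cons ((m : ℤ) + k) fun i => (t i : ℤ) + k - (i : ℕ)) = 0 := by
  have := interDet_cons_eq_zero x y fun i => (t i : ℤ) + k - (i : ℕ)
  simpa [ht] using this

theorem interSum_zero {k : ℕ} (x : Fin (k + 1) → F) (y : F) (h0 : ∀ j, x j ≠ 0) (hy0 : y ≠ 0)
    (hxy : ∀ j, x j ≠ y) (hxy1 : ∀ j, x j * y ≠ 1) :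
    interSum x y 0 = ∑ j : Fin (k + 1), (-1) ^ (j : ℕ) *
        (x j ^ ((k + 1 : ℕ) : ℤ) - x j ^ (-((k + 1 : ℕ) : ℤ))) *
          interSum (x ∘ j.succAbove) y 0 := by
  rw [interSum, sum_columnParityPartitions_zero]
  simp only [cons_shift]
  rw [sum_interDet_cons x y h0 hy0 hxy hxy1, Finset.sum_eq_zero, mul_zero, zero_add]
  · simp only [Nat.cast_zero, zero_add]
  · intro t ht
    exact interDet_cons_head x y (by simpa using (mem_columnParityPartitions.1 ht).1 0)

theorem interSum_succ {k : ℕ} (x : Fin (k + 1) → F) (y : F) (h0 : ∀ j, x j ≠ 0) (hy0 : y ≠ 0)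
    (hxy : ∀ j, x j ≠ y) (hxy1 : ∀ j, x j * y ≠ 1) (m : ℕ) :
    interSum x y (m + 1) = (if Even (k + 2) then 1 else y) * interSum x y m +
      ∑ j : Fin (k + 1), (-1) ^ (j : ℕ) *
        (x j ^ (((m + 1 : ℕ) : ℤ) + ((k + 1 : ℕ) : ℤ)) -
          x j ^ (-(((m + 1 : ℕ) : ℤ) + ((k + 1 : ℕ) : ℤ)))) *
          interSum (x ∘ j.succAbove) y (m + 1) := by
  by_cases hk : Even (k + 1)
  · rw [if_neg (by rw [Nat.even_add_one]; exact not_not.2 hk)]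
    rw [interSum, interSum, sum_columnParityPartitions_of_even hk,
      sum_columnParityPartitions_of_even hk]
    simp only [cons_shift]
    rw [sum_interDet_cons x y h0 hy0 hxy hxy1, sum_columnParityPartitions_of_odd hk]
    have hhead : ∑ t ∈ columnParityPartitions (m + 1) k,
        interDet x y (Fin.cons (((m + 1 : ℕ) : ℤ) + k) fun i =>
          (((Fin.cons (m + 1) t : Fin (k + 1) → ℕ) i : ℕ) : ℤ) + k - (i : ℕ)) = 0 :=
      Finset.sum_eq_zero fun t _ => interDet_cons_head x y (Fin.cons_zero _ _)
    have hshift : ((m + 1 : ℕ) : ℤ) + k = m + ((k + 1 : ℕ) : ℤ) := by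
      push_cast
      ring
    rw [hhead, add_zero, hshift]
  · have hk' : Even (k + 2) := by rw [Nat.even_add_one]; exact hk
    have hk'' : Even k := by rw [Nat.even_add_one] at hk; exact not_not.1 hk
    rw [if_pos hk', one_mul, interSum, sum_columnParityPartitions_of_odd hk', interSum]
    congr 1
    simp only [cons_shift]
    rw [sum_interDet_cons x y h0 hy0 hxy hxy1, Finset.sum_eq_zero, mul_zero, zero_add]
    intro t ht
    exact interDet_cons_head x y (columnParityPartitions_head_eq hk'' ht)

theorem interSum_fin_zero (x : Fin 0 → F) (y : F) (m : ℕ) : interSum x y m = y ^ m := by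
  rw [interSum, sum_columnParityPartitions_of_even (by simp)]
  have : columnParityPartitions m 0 = {default} := by
    ext t
    rw [mem_columnParityPartitions]
    simp [Subsingleton.elim t default, Subsingleton.antitone]
  simp [this, interDet, interRow, Matrix.det_unique, Fin.snoc]

end InterDet

section PairSet

/-- The set of the values of `x` and of their inverses. -/
def pairSet {k : ℕ} (x : Fin k → F) : Finset F :=
  Finset.univ.image x ∪ Finset.univ.image fun j => (x j)⁻¹

/-- The Weyl denominator of type `C`. -/
def weylDenom {k : ℕ} (x : Fin k → F) : F :=
  (∏ j, (x j - (x j)⁻¹)) *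
    ∏ i, ∏ j, if i < j then x i + (x i)⁻¹ - (x j + (x j)⁻¹) else 1

theorem mem_pairSet {k : ℕ} {x : Fin k → F} {z : F} :
    z ∈ pairSet x ↔ ∃ j, z = x j ∨ z = (x j)⁻¹ := by
  simp only [pairSet, Finset.mem_union, Finset.mem_image, Finset.mem_univ, true_and, ← exists_or]
  exact exists_congr fun j => by rw [eq_comm, @eq_comm _ (x j)⁻¹]

theorem prod_sub_succAbove {k : ℕ} (t : Fin (k + 1) → F) (j : Fin (k + 1)) :
    (∏ i, ∏ l, if i < l then t i - t l else 1) = (-1) ^ (j : ℕ) *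
      (∏ i, (t j - t (j.succAbove i))) *
      ∏ i, ∏ l, if i < l then t (j.succAbove i) - t (j.succAbove l) else 1 := by
  rw [Fin.prod_univ_succAbove _ j, Fin.prod_univ_succAbove _ j]
  simp only [Fin.prod_univ_succAbove _ j, lt_irrefl, if_false, one_mul,
    Fin.succAbove_lt_succAbove_iff, Finset.prod_mul_distrib]
  rw [← mul_assoc]
  congr 1
  have hsign : (-1 : F) ^ (j : ℕ) = ∏ i : Fin k, if j.succAbove i < j then -1 else 1 := by
    rw [Finset.prod_ite, Finset.prod_const_one, mul_one, Finset.prod_const]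
    congr 1
    simp only [Fin.succAbove_lt_iff_castSucc_lt]
    have : (Finset.univ.filter fun i : Fin k => i.castSucc < j) =
        Finset.univ.filter fun i : Fin k => (i : ℕ) < j := by
      ext i
      simp [Fin.lt_def]
    rw [this, Fin.card_filter_val_lt]
    have := j.isLt
    omega
  rw [hsign, ← Finset.prod_mul_distrib, ← Finset.prod_mul_distrib]
  refine Finset.prod_congr rfl fun i _ => ?_
  rcases lt_or_gt_of_ne (Fin.succAbove_ne j i) with h | h
  · rw [if_neg h.not_gt, if_pos h, if_pos h]
    ring
  · rw [if_neg h.not_gt, if_pos h, if_neg h.not_gt]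
    ring

theorem weylDenom_succAbove {k : ℕ} (x : Fin (k + 1) → F) (j : Fin (k + 1)) :
    weylDenom x = (-1) ^ (j : ℕ) * (x j - (x j)⁻¹) *
      (∏ i, (x j + (x j)⁻¹ - (x (j.succAbove i) + (x (j.succAbove i))⁻¹))) *
      weylDenom (x ∘ j.succAbove) := by
  rw [weylDenom, weylDenom, prod_sub_succAbove (fun i => x i + (x i)⁻¹) j,
    Fin.prod_univ_succAbove _ j]
  simp only [Function.comp_apply]
  ring

variable {k : ℕ} {x : Fin k → F}

theorem add_inv_sub_add_inv_ne_zero {a b : F} (ha : a ≠ 0) (hb : b ≠ 0) (hab : a ≠ b)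
    (hab1 : a * b ≠ 1) : a + a⁻¹ - (b + b⁻¹) ≠ 0 := by
  have : a + a⁻¹ - (b + b⁻¹) = (a - b) * (a * b - 1) / (a * b) := by
    field_simp
    ring
  rw [this]
  exact div_ne_zero (mul_ne_zero (sub_ne_zero.2 hab) (sub_ne_zero.2 hab1)) (mul_ne_zero ha hb)

theorem sub_inv_ne_zero {a : F} (ha : a ≠ 0) (ha1 : a * a ≠ 1) : a - a⁻¹ ≠ 0 := by
  intro h
  apply ha1
  linear_combination a * h + mul_inv_cancel₀ ha

theorem weylDenom_ne_zero (h0 : ∀ j, x j ≠ 0) (hx : Function.Injective x)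
    (hx1 : ∀ i j, x i * x j ≠ 1) : weylDenom x ≠ 0 := by
  refine mul_ne_zero (Finset.prod_ne_zero_iff.2 fun j _ => sub_inv_ne_zero (h0 j) (hx1 j j))
    (Finset.prod_ne_zero_iff.2 fun i _ => Finset.prod_ne_zero_iff.2 fun j _ => ?_)
  split_ifs with h
  · exact add_inv_sub_add_inv_ne_zero (h0 i) (h0 j) (fun e => h.ne (hx e)) (hx1 i j)
  · exact one_ne_zero

theorem ne_inv_of_mul_ne_one {a b : F} (hb : b ≠ 0) (h : a * b ≠ 1) : a ≠ b⁻¹ := by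
  rintro rfl
  exact h (inv_mul_cancel₀ hb)

theorem zero_notMem_pairSet (h0 : ∀ j, x j ≠ 0) : (0 : F) ∉ pairSet x := by
  rw [mem_pairSet]
  rintro ⟨j, h | h⟩
  · exact h0 j h.symm
  · exact inv_ne_zero (h0 j) h.symm

theorem inv_mem_pairSet {z : F} (hz : z ∈ pairSet x) : z⁻¹ ∈ pairSet x := by
  rw [mem_pairSet] at *
  obtain ⟨j, rfl | rfl⟩ := hz
  · exact ⟨j, Or.inr rfl⟩
  · exact ⟨j, Or.inl (inv_inv _)⟩

theorem ne_inv_of_mem_pairSet (h0 : ∀ j, x j ≠ 0) (hx1 : ∀ i j, x i * x j ≠ 1) {z : F}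
    (hz : z ∈ pairSet x) : z ≠ z⁻¹ := by
  rw [mem_pairSet] at hz
  obtain ⟨j, rfl | rfl⟩ := hz
  · exact ne_inv_of_mul_ne_one (h0 j) (hx1 j j)
  · rw [inv_inv]
    exact (ne_inv_of_mul_ne_one (h0 j) (hx1 j j)).symm

theorem disjoint_image_inv (h0 : ∀ j, x j ≠ 0) (hx1 : ∀ i j, x i * x j ≠ 1) :
    Disjoint (Finset.univ.image x) (Finset.univ.image fun j => (x j)⁻¹) := by
  rw [Finset.disjoint_left]
  simp only [Finset.mem_image, Finset.mem_univ, true_and]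
  rintro _ ⟨i, rfl⟩ ⟨j, h⟩
  exact ne_inv_of_mul_ne_one (h0 j) (hx1 i j) h.symm

theorem sum_pairSet (h0 : ∀ j, x j ≠ 0) (hx : Function.Injective x)
    (hx1 : ∀ i j, x i * x j ≠ 1) (g : F → F) :
    ∑ z ∈ pairSet x, g z = ∑ j, (g (x j) + g (x j)⁻¹) := by
  rw [pairSet, Finset.sum_union (disjoint_image_inv h0 hx1),
    Finset.sum_image fun a _ b _ h => hx h,
    Finset.sum_image fun a _ b _ h => hx (inv_injective h), Finset.sum_add_distrib]

theorem prod_pairSet (h0 : ∀ j, x j ≠ 0) (hx : Function.Injective x)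
    (hx1 : ∀ i j, x i * x j ≠ 1) (g : F → F) :
    ∏ z ∈ pairSet x, g z = ∏ j, (g (x j) * g (x j)⁻¹) := by
  rw [pairSet, Finset.prod_union (disjoint_image_inv h0 hx1),
    Finset.prod_image fun a _ b _ h => hx h,
    Finset.prod_image fun a _ b _ h => hx (inv_injective h), Finset.prod_mul_distrib]

theorem card_pairSet (h0 : ∀ j, x j ≠ 0) (hx : Function.Injective x)
    (hx1 : ∀ i j, x i * x j ≠ 1) : (pairSet x).card = 2 * k := by
  rw [pairSet, Finset.card_union_of_disjoint (disjoint_image_inv h0 hx1),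
    Finset.card_image_of_injective _ hx,
    Finset.card_image_of_injective _ (f := fun j => (x j)⁻¹) (inv_injective.comp hx),
    Finset.card_fin]
  ring

theorem pairSet_erase_erase {x : Fin (k + 1) → F} (h0 : ∀ j, x j ≠ 0)
    (hx : Function.Injective x) (hx1 : ∀ i j, x i * x j ≠ 1) (j : Fin (k + 1)) :
    ((pairSet x).erase (x j)).erase (x j)⁻¹ = pairSet (x ∘ j.succAbove) := by
  ext z
  simp only [Finset.mem_erase, mem_pairSet, Function.comp_apply]
  constructor
  · rintro ⟨h1, h2, i, hi⟩
    rcases Fin.eq_self_or_eq_succAbove j i with rfl | ⟨l, rfl⟩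
    · tauto
    · exact ⟨l, hi⟩
  · rintro ⟨l, hl⟩
    refine ⟨?_, ?_, j.succAbove l, hl⟩
    · rintro rfl
      rcases hl with h | h
      · exact ne_inv_of_mul_ne_one (h0 j) (hx1 _ j) h.symm
      · exact Fin.ne_succAbove j l (hx (inv_injective h))
    · rintro rfl
      rcases hl with h | h
      · exact Fin.ne_succAbove j l (hx h)
      · exact ne_inv_of_mul_ne_one (h0 _) (hx1 _ _) h

/-- The partial fraction coefficient at `z`, where `z` is `x j` or its inverse. -/
theorem prod_pairSet_erase {x : Fin (k + 1) → F} (h0 : ∀ j, x j ≠ 0)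
    (hx : Function.Injective x) (hx1 : ∀ i j, x i * x j ≠ 1) (j : Fin (k + 1)) {z : F}
    (hz : z = x j ∨ z = (x j)⁻¹) (m : ℤ) :
    z ^ m * ∏ s ∈ (pairSet x).erase z, (1 - s * z⁻¹)⁻¹ =
      z ^ (m + ((k + 1 : ℕ) : ℤ)) * (z - z⁻¹)⁻¹ *
      (∏ i, (x j + (x j)⁻¹ - (x (j.succAbove i) + (x (j.succAbove i))⁻¹)))⁻¹ := by
  have hz0 : z ≠ 0 := by
    rcases hz with rfl | rfl
    · exact h0 j
    · exact inv_ne_zero (h0 j)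
  have hzmem : z ∈ pairSet x := mem_pairSet.2 ⟨j, hz⟩
  have hzi : z⁻¹ ∈ (pairSet x).erase z :=
    Finset.mem_erase.2 ⟨(ne_inv_of_mem_pairSet h0 hx1 hzmem).symm, inv_mem_pairSet hzmem⟩
  have herase : ((pairSet x).erase z).erase z⁻¹ = pairSet (x ∘ j.succAbove) := by
    rw [← pairSet_erase_erase h0 hx hx1 j]
    rcases hz with rfl | rfl
    · rfl
    · rw [inv_inv, Finset.erase_right_comm]
  have hsum : x j + (x j)⁻¹ = z + z⁻¹ := by
    rcases hz with rfl | rfl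
    · rfl
    · rw [inv_inv, add_comm]
  rw [← Finset.mul_prod_erase _ _ hzi, herase,
    prod_pairSet (x := x ∘ j.succAbove) (fun i => h0 _)
      (hx.comp Fin.succAbove_right_injective) (fun _ _ => hx1 _ _), hsum]
  have hfac : ∀ i, (1 - (x ∘ j.succAbove) i * z⁻¹)⁻¹ * (1 - ((x ∘ j.succAbove) i)⁻¹ * z⁻¹)⁻¹ =
      z * (z + z⁻¹ - (x (j.succAbove i) + (x (j.succAbove i))⁻¹))⁻¹ := by
    intro i
    have hi := h0 (j.succAbove i)
    rw [Function.comp_apply, ← mul_inv, ← inv_inv z, ← mul_inv, inv_inv]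
    field_simp
    ring
  simp only [hfac]
  rw [Finset.prod_mul_distrib, Finset.prod_const, Finset.card_fin, Finset.prod_inv_distrib]
  have h2 : (1 - z⁻¹ * z⁻¹)⁻¹ = z * (z - z⁻¹)⁻¹ := by
    rw [← inv_inv z, ← mul_inv, inv_inv]
    field_simp
  rw [h2, Nat.cast_add, Nat.cast_one, zpow_add₀ hz0, zpow_add_one₀ hz0, zpow_natCast]
  ring

theorem weylDenom_mul_pair {x : Fin (k + 1) → F} (h0 : ∀ j, x j ≠ 0)
    (hx : Function.Injective x) (hx1 : ∀ i j, x i * x j ≠ 1) (j : Fin (k + 1)) (m : ℤ) :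
    weylDenom x * (x j ^ m * (∏ s ∈ (pairSet x).erase (x j), (1 - s * (x j)⁻¹)⁻¹) +
      (x j)⁻¹ ^ m * ∏ s ∈ (pairSet x).erase (x j)⁻¹, (1 - s * (x j)⁻¹⁻¹)⁻¹) =
    (-1) ^ (j : ℕ) * (x j ^ (m + ((k + 1 : ℕ) : ℤ)) - x j ^ (-(m + ((k + 1 : ℕ) : ℤ)))) *
      weylDenom (x ∘ j.succAbove) := by
  rw [prod_pairSet_erase h0 hx hx1 j (Or.inl rfl), prod_pairSet_erase h0 hx hx1 j (Or.inr rfl),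
    weylDenom_succAbove x j, _root_.inv_zpow', inv_inv]
  have h1 := sub_inv_ne_zero (h0 j) (hx1 j j)
  have h2 : ∏ i, (x j + (x j)⁻¹ - (x (j.succAbove i) + (x (j.succAbove i))⁻¹)) ≠ 0 :=
    Finset.prod_ne_zero_iff.2 fun i _ => add_inv_sub_add_inv_ne_zero (h0 _) (h0 _)
      (fun e => Fin.ne_succAbove j i (hx e)) (hx1 _ _)
  rw [← neg_sub (x j) (x j)⁻¹, inv_neg]
  generalize x j - (x j)⁻¹ = u at *
  generalize ∏ i, (x j + (x j)⁻¹ - (x (j.succAbove i) + (x (j.succAbove i))⁻¹)) = v at *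
  generalize x j ^ (m + ((k + 1 : ℕ) : ℤ)) = a
  generalize x j ^ (-(m + ((k + 1 : ℕ) : ℤ))) = b
  field_simp
  ring

theorem exists_injective_image_eq {α : Type*} (Z : Finset α) :
    ∃ z : Fin Z.card → α, Function.Injective z ∧ Finset.univ.image z = Z := by
  refine ⟨fun i => Z.equivFin.symm i, Subtype.val_injective.comp Z.equivFin.symm.injective, ?_⟩
  ext a
  simp only [Finset.mem_image, Finset.mem_univ, true_and]
  constructor
  · rintro ⟨i, rfl⟩
    exact (Z.equivFin.symm i).2
  · intro ha
    exact ⟨Z.equivFin ⟨a, ha⟩, by simp⟩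

theorem rectSum_finset_neg_one {Z : Finset F} (hZ : (0 : F) ∉ Z) {n : ℕ} (h1 : 0 < n)
    (hn : n < Z.card) : rectSum Z n (-1) = 0 := by
  obtain ⟨z, hz, hzZ⟩ := exists_injective_image_eq Z
  have := rectSum_neg_one hn h1 z (fun j h => hZ (by
    rw [← hzZ, ← h]
    exact Finset.mem_image_of_mem _ (Finset.mem_univ _))) hz
  rwa [hzZ] at this

theorem rectSum_finset_zero {Z : Finset F} (hZ : (0 : F) ∉ Z) {n : ℕ} (hn : n ≤ Z.card) :
    rectSum Z n 0 = 1 := by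
  obtain ⟨z, hz, hzZ⟩ := exists_injective_image_eq Z
  have := rectSum_zero hn z (fun j h => hZ (by
    rw [← hzZ, ← h]
    exact Finset.mem_image_of_mem _ (Finset.mem_univ _))) hz
  rwa [hzZ] at this

theorem notMem_pairSet {y : F} (h0 : ∀ j, x j ≠ 0) (hxy : ∀ j, x j ≠ y)
    (hxy1 : ∀ j, x j * y ≠ 1) : y ∉ pairSet x := by
  rw [mem_pairSet]
  rintro ⟨j, h | h⟩
  · exact hxy j h.symm
  · exact ne_inv_of_mul_ne_one (h0 j) (by rw [mul_comm]; exact hxy1 j) h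

/-- `rectSum_succ` for the pairs `x j`, `(x j)⁻¹`, multiplied by the Weyl denominator. -/
theorem weylDenom_mul_rectSum {x : Fin (k + 1) → F} {y : F} (h2 : (2 : F) ≠ 0)
    (h0 : ∀ j, x j ≠ 0) (hx : Function.Injective x) (hx1 : ∀ i j, x i * x j ≠ 1) (hy0 : y ≠ 0)
    (hxy : ∀ j, x j ≠ y) (hxy1 : ∀ j, x j * y ≠ 1) (m : ℤ) :
    weylDenom x * rectSum (insert y (pairSet x)) (k + 2) m =
      (if Even (k + 2) then 1 else y) *
        (weylDenom x * rectSum (insert y (pairSet x)) (k + 2) (m - 1)) +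
      ∑ j : Fin (k + 1), (-1) ^ (j : ℕ) *
        (x j ^ (m + ((k + 1 : ℕ) : ℤ)) - x j ^ (-(m + ((k + 1 : ℕ) : ℤ)))) *
        (weylDenom (x ∘ j.succAbove) *
          rectSum (insert y (pairSet (x ∘ j.succAbove))) (k + 1) m) := by
  rw [rectSum_succ h2 (zero_notMem_pairSet h0) (fun z => inv_mem_pairSet)
    (fun z => ne_inv_of_mem_pairSet h0 hx1) hy0 (notMem_pairSet h0 hxy hxy1) (k + 1) m,
    sum_pairSet h0 hx hx1, mul_add, Finset.mul_sum, mul_left_comm]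
  congr 1
  refine Finset.sum_congr rfl fun j _ => ?_
  rw [inv_inv, Finset.erase_right_comm (a := (x j)⁻¹), pairSet_erase_erase h0 hx hx1, ← add_mul,
    ← mul_assoc, ← mul_assoc, ← weylDenom_mul_pair h0 hx hx1, inv_inv]

theorem interSum_eq_rectSum {k : ℕ} {x : Fin k → F} {y : F} (h2 : (2 : F) ≠ 0)
    (h0 : ∀ j, x j ≠ 0) (hx : Function.Injective x) (hx1 : ∀ i j, x i * x j ≠ 1) (hy0 : y ≠ 0)
    (hxy : ∀ j, x j ≠ y) (hxy1 : ∀ j, x j * y ≠ 1) (m : ℕ) :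
    interSum x y m = weylDenom x * rectSum (insert y (pairSet x)) (k + 1) m := by
  induction k generalizing m with
  | zero =>
    rw [interSum_fin_zero]
    have hpair : pairSet x = ∅ := by simp [pairSet]
    have hpow : ({y} : Finset F).powersetCard 1 = {{y}} := by
      rw [← Finset.card_singleton y, Finset.powersetCard_self]
    simp [hpair, weylDenom, rectSum, hpow]
  | succ k ih =>
    have ih' : ∀ (j : Fin (k + 1)) (m : ℕ), interSum (x ∘ j.succAbove) y m =
        weylDenom (x ∘ j.succAbove) *
          rectSum (insert y (pairSet (x ∘ j.succAbove))) (k + 1) m := fun j m =>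
      ih (fun i => h0 _) (hx.comp Fin.succAbove_right_injective) (fun _ _ => hx1 _ _)
        (fun _ => hxy _) (fun _ => hxy1 _) m
    induction m with
    | zero =>
      have hcard : (insert y (pairSet x)).card = 2 * (k + 1) + 1 := by
        rw [Finset.card_insert_of_notMem (notMem_pairSet h0 hxy hxy1), card_pairSet h0 hx hx1]
      rw [interSum_zero x y h0 hy0 hxy hxy1, weylDenom_mul_rectSum h2 h0 hx hx1 hy0 hxy hxy1,
        Nat.cast_zero, zero_sub, rectSum_finset_neg_one (by
          simp [zero_notMem_pairSet h0, hy0.symm]) (by omega) (by omega)]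
      simp only [ih', zero_add, mul_zero, Nat.cast_zero]
    | succ m ihm =>
      rw [interSum_succ x y h0 hy0 hxy hxy1, weylDenom_mul_rectSum h2 h0 hx hx1 hy0 hxy hxy1, ihm]
      simp only [ih']
      rw [show ((m + 1 : ℕ) : ℤ) - 1 = m by push_cast; ring]

end PairSet

section Specialization

theorem interMatP_one {k : ℕ} (z : Fin (k + 1) → F) (μ : Fin (k + 1) → ℤ) :
    (interMatP k z μ).det =
      interDet (fun j => z j.castSucc) (z (Fin.last k)) fun i => μ i + k - (i : ℕ) := by
  have hfilter : Finset.univ.filter (fun l : Fin (k + 1) => k ≤ (l : ℕ)) = {Fin.last k} := by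
    ext l
    simp only [Finset.mem_filter, Finset.mem_univ, true_and, Finset.mem_singleton, Fin.ext_iff,
      Fin.val_last]
    have := l.isLt
    omega
  rw [interDet]
  congr 1
  ext i j
  rw [interMatP, Matrix.of_apply, Matrix.of_apply, hfilter, Finset.prod_singleton,
    Finset.prod_singleton, interRow]
  induction j using Fin.lastCases with
  | last =>
    rw [if_neg (by simp), Fin.snoc_last]
    congr 1
    push_cast
    ring
  | cast j => rw [if_pos (by simp), Fin.snoc_castSucc]

theorem sum_spInterP_eq_rectSum {k : ℕ} (z : Fin (k + 1) → F) (h2 : (2 : F) ≠ 0)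
    (h0 : ∀ j, z j ≠ 0) (hz : Function.Injective z) (hz1 : ∀ i j, z i * z j ≠ 1) (m : ℕ) :
    ∑ lam ∈ columnParityPartitions m (k + 1), spInterP k z (fun i => (lam i : ℤ)) =
      rectSum (insert (z (Fin.last k)) (pairSet fun j => z j.castSucc)) (k + 1) m := by
  have hx : Function.Injective fun j : Fin k => z j.castSucc :=
    hz.comp (Fin.castSucc_injective k)
  have hxy : ∀ j : Fin k, z j.castSucc ≠ z (Fin.last k) := fun j h =>
    (Fin.castSucc_lt_last j).ne (hz h)
  have hx1 : ∀ i j : Fin k, z i.castSucc * z j.castSucc ≠ 1 := fun _ _ => hz1 _ _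
  have hxy1 : ∀ j : Fin k, z j.castSucc * z (Fin.last k) ≠ 1 := fun _ => hz1 _ _
  have key := interSum_eq_rectSum h2 (fun j => h0 _) hx hx1 (h0 (Fin.last k)) hxy hxy1
  have hW := weylDenom_ne_zero (fun j : Fin k => h0 j.castSucc) hx hx1
  have hdenom : (interMatP k z fun _ => 0).det = weylDenom fun j => z j.castSucc := by
    have hcard : (insert (z (Fin.last k)) (pairSet fun j => z j.castSucc)).card = 2 * k + 1 := by
      rw [Finset.card_insert_of_notMem (notMem_pairSet (fun j => h0 _) hxy hxy1),
        card_pairSet (fun j => h0 _) hx hx1]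
    have := key 0
    rw [Nat.cast_zero, rectSum_finset_zero (by
        simp [zero_notMem_pairSet fun j : Fin k => h0 j.castSucc, (h0 (Fin.last k)).symm])
        (by omega), mul_one, interSum, columnParityPartitions_zero, Finset.sum_singleton] at this
    rw [← this, interMatP_one]
    simp only [Pi.zero_apply, Nat.cast_zero]
  simp only [spInterP, hdenom, interMatP_one]
  rw [← Finset.sum_div, div_eq_iff hW, mul_comm, ← key m, interSum]

theorem sum_filter_eq_sum_columnParityPartitions {n m : ℕ} (f : (Fin n → ℕ) → F) :
    ∑ lam ∈ Finset.univ.filter (fun lam : Fin n → Fin (m + 1) =>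
        (Antitone fun i => (lam i : ℕ)) ∧ ∀ c : ℕ, 1 ≤ c → c ≤ m →
          (Even (Finset.univ.filter (fun j : Fin n => c ≤ (lam j : ℕ))).card ↔ Even n)),
      f (fun i => (lam i : ℕ)) = ∑ lam ∈ columnParityPartitions m n, f lam := by
  refine Finset.sum_bij (fun lam _ i => (lam i : ℕ)) ?_ ?_ ?_ ?_
  · intro lam h
    rw [mem_columnParityPartitions]
    exact ⟨fun i => Nat.lt_succ_iff.1 (lam i).isLt, (Finset.mem_filter.1 h).2⟩
  · intro a _ b _ h
    funext i
    exact Fin.ext (congrFun h i)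
  · intro lam h
    rw [mem_columnParityPartitions] at h
    exact ⟨fun i => ⟨lam i, Nat.lt_succ_iff.2 (h.1 i)⟩, Finset.mem_filter.2
      ⟨Finset.mem_univ _, h.2⟩, rfl⟩
  · intro _ _
    rfl

/-- The variables `x_1, x_1⁻¹, …, x_k, x_k⁻¹, x_{k+1}`. -/
theorem image_interleave {k : ℕ} (z : Fin (k + 1) → F) :
    (Finset.univ.image fun j : Fin (2 * (k + 1) - 1) =>
      if (j : ℕ) % 2 = 0 then z ⟨(j : ℕ) / 2, by have := j.isLt; omega⟩
      else (z ⟨(j : ℕ) / 2, by have := j.isLt; omega⟩)⁻¹) =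
    insert (z (Fin.last k)) (pairSet fun j => z j.castSucc) := by
  ext a
  simp only [Finset.mem_image, Finset.mem_univ, true_and, Finset.mem_insert, mem_pairSet]
  constructor
  · rintro ⟨j, rfl⟩
    have := j.isLt
    rcases Nat.lt_or_ge ((j : ℕ) / 2) k with h | h
    · refine Or.inr ⟨⟨(j : ℕ) / 2, h⟩, ?_⟩
      split_ifs
      · exact Or.inl rfl
      · exact Or.inr rfl
    · left
      rw [if_pos (by omega)]
      congr 1
      ext
      rw [Fin.val_last]
      change (j : ℕ) / 2 = k
      omega
  · rintro (rfl | ⟨j, rfl | rfl⟩)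
    · refine ⟨⟨2 * k, by omega⟩, ?_⟩
      rw [if_pos (by simp)]
      congr 1
      ext
      simp
    · have := j.isLt
      refine ⟨⟨2 * j, by omega⟩, ?_⟩
      rw [if_pos (by simp)]
      congr 1
      ext
      simp
    · have := j.isLt
      refine ⟨⟨2 * j + 1, by omega⟩, ?_⟩
      rw [if_neg (by simp)]
      congr 2
      ext
      simp
      omega

theorem injective_interleave {k : ℕ} {z : Fin (k + 1) → F} (h0 : ∀ j, z j ≠ 0)
    (hz : Function.Injective z) (hz1 : ∀ i j, z i * z j ≠ 1) :
    Function.Injective fun j : Fin (2 * (k + 1) - 1) =>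
      if (j : ℕ) % 2 = 0 then z ⟨(j : ℕ) / 2, by have := j.isLt; omega⟩
      else (z ⟨(j : ℕ) / 2, by have := j.isLt; omega⟩)⁻¹ := by
  intro i j h
  dsimp only at h
  ext
  split_ifs at h with h1 h2 h2
  · have := Fin.mk.inj (hz h)
    omega
  · exact absurd h (ne_inv_of_mul_ne_one (h0 _) (hz1 _ _))
  · exact absurd h.symm (ne_inv_of_mul_ne_one (h0 _) (hz1 _ _))
  · have := Fin.mk.inj (hz (inv_injective h))
    omega

theorem schurP_rectangle_interleave {k : ℕ} {z : Fin (k + 1) → F} (h0 : ∀ j, z j ≠ 0)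
    (hz : Function.Injective z) (hz1 : ∀ i j, z i * z j ≠ 1) (m : ℤ) :
    schurP (fun j : Fin (2 * (k + 1) - 1) =>
        if (j : ℕ) % 2 = 0 then z ⟨(j : ℕ) / 2, by have := j.isLt; omega⟩
        else (z ⟨(j : ℕ) / 2, by have := j.isLt; omega⟩)⁻¹)
      (fun j => if (j : ℕ) < k + 1 then m else 0) =
    rectSum (insert (z (Fin.last k)) (pairSet fun j => z j.castSucc)) (k + 1) m := by
  rw [schurP_rectangle (by omega) _ (fun j => ?_) (injective_interleave h0 hz hz1),
    image_interleave]
  split_ifs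
  · exact h0 _
  · exact inv_ne_zero (h0 _)

end Specialization

theorem gen_injective (n : ℕ) : Function.Injective (gen n) :=
  (IsFractionRing.injective (MvPolynomial (Fin n) ℚ) (FF n)).comp (MvPolynomial.X_injective)

theorem gen_ne_zero (n : ℕ) (i : Fin n) : gen n i ≠ 0 := fun h =>
  MvPolynomial.X_ne_zero (R := ℚ) i
    (IsFractionRing.injective (MvPolynomial (Fin n) ℚ) (FF n) (h.trans (map_zero _).symm))

theorem gen_mul_gen_ne_one (n : ℕ) (i j : Fin n) : gen n i * gen n j ≠ 1 := by
  intro h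
  rw [gen, gen, ← map_mul] at h
  have := IsFractionRing.injective (MvPolynomial (Fin n) ℚ) (FF n) (h.trans (map_one _).symm)
  simpa using congrArg MvPolynomial.constantCoeff this

theorem two_ne_zero_FF (n : ℕ) : (2 : FF n) ≠ 0 := by
  have : CharZero (FF n) :=
    charZero_of_injective_algebraMap (IsFractionRing.injective (MvPolynomial (Fin n) ℚ) (FF n))
  exact two_ne_zero

/-- **Corollary.**  For `n ≥ 1` and a positive integer `m`, the Schur function of rectangular
shape `(m^n)` in the `2n-1` variables `(x_1, x_1^{-1}, …, x_{n-1}, x_{n-1}^{-1}, x_n)` equals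
the sum of the intermediate symplectic characters `sp^{(n-1,1)}_λ(x_1,…,x_{n-1} | x_n)` over all
partitions `λ ⊆ (m^n)` all of whose column lengths are even if `n` is even, and over all those
all of whose column lengths are odd if `n` is odd; an identity in `ℚ(x_1, …, x_n)`.
Here `gen n i` plays the role of `x_i`, and the column length `λ′_c` is the number of indices
`j` with `λ_j ≥ c`. -/
theorem schur_rectangle_eq_sum_spInter_columns (n m : ℕ) (hn : 1 ≤ n) (hm : 0 < m) :
    schurP
      (fun j : Fin (2 * n - 1) =>
        if (j : ℕ) % 2 = 0 then gen n ⟨(j : ℕ) / 2, by have := j.isLt; omega⟩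
        else (gen n ⟨(j : ℕ) / 2, by have := j.isLt; omega⟩)⁻¹)
      (fun j => if (j : ℕ) < n then (m : ℤ) else 0) =
    if Even n then
      ∑ lam ∈ Finset.univ.filter
          (fun lam : Fin n → Fin (m + 1) =>
            (Antitone fun i => (lam i : ℕ)) ∧
            ∀ c : ℕ, 1 ≤ c → c ≤ m →
              Even (Finset.univ.filter (fun j : Fin n => c ≤ (lam j : ℕ))).card),
        spInterP (n - 1) (gen n) (fun i => ((lam i : ℕ) : ℤ))
    else
      ∑ lam ∈ Finset.univ.filter
          (fun lam : Fin n → Fin (m + 1) =>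
            (Antitone fun i => (lam i : ℕ)) ∧
            ∀ c : ℕ, 1 ≤ c → c ≤ m →
              Odd (Finset.univ.filter (fun j : Fin n => c ≤ (lam j : ℕ))).card),
        spInterP (n - 1) (gen n) (fun i => ((lam i : ℕ) : ℤ)) := by
  obtain ⟨k, rfl⟩ : ∃ k, n = k + 1 := ⟨n - 1, by omega⟩
  rw [schurP_rectangle_interleave (gen_ne_zero _) (gen_injective _) (gen_mul_gen_ne_one _),
    ← sum_spInterP_eq_rectSum _ (two_ne_zero_FF _) (gen_ne_zero _) (gen_injective _)
      (gen_mul_gen_ne_one _),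
    ← sum_filter_eq_sum_columnParityPartitions]
  split_ifs with h
  · simp only [h, iff_true]
    rfl
  · simp only [h, iff_false, Nat.not_even_iff_odd]
    rfl
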